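/- With the operators E, F, H, X, Y on V as above and W⁺ = (1/2)X², W⁰ = -(1/2)(XY+YX), W⁻ = -(1/2)Y², the Casimir relation C₂ = 2(EW⁻ + FW⁺) + HW⁰ + m(m-ℏ) holds on V, where C₂ = 2(EF+FE) + H² and m = -((2ℓ+1)/2)ℏ. -/

import Mathlib

attribute [local instance] Classical.propDecidable

noncomputable section

/-- The coefficient field `ℂ(ℏ)`. -/
abbrev Fh : Type := RatFunc ℂ

/-- The generator `ℏ` of `ℂ(ℏ)`. -/
def hb : Fh := RatFunc.X

/-- Admissibility of the index `(A₁, A₂)`: `0 ≤ A₁ ≤ A₂ ≤ A₁ + 2ℓ + 1`. -/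
def Adm (ℓ : ℕ) (A : ℤ × ℤ) : Prop :=
  0 ≤ A.1 ∧ A.1 ≤ A.2 ∧ A.2 ≤ A.1 + (2 * ℓ + 1)

/-- The vector space `V` with basis `|A₁, A₂⟩` indexed by admissible pairs. -/
abbrev V (ℓ : ℕ) : Type := {A : ℤ × ℤ // Adm ℓ A} →₀ Fh

/-- The basis vector `|A₁, A₂⟩`, with out-of-range indices giving `0`. -/
def ket (ℓ : ℕ) (A : ℤ × ℤ) : V ℓ :=
  if h : Adm ℓ A then Finsupp.single ⟨A, h⟩ 1 else 0

/-- `E |A₁,A₂⟩ = |A₁+1, A₂+1⟩`. -/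
def opE (ℓ : ℕ) : V ℓ →ₗ[Fh] V ℓ :=
  Finsupp.lsum Fh fun A =>
    LinearMap.toSpanSingleton Fh (V ℓ) (ket ℓ (A.1.1 + 1, A.1.2 + 1))

/-- `F |A₁,A₂⟩ = A₁ ((2ℓ+1)/2 - A₂) ℏ² |A₁-1, A₂-1⟩`. -/
def opF (ℓ : ℕ) : V ℓ →ₗ[Fh] V ℓ :=
  Finsupp.lsum Fh fun A =>
    LinearMap.toSpanSingleton Fh (V ℓ)
      (((((A.1.1 : ℚ) * ((2 * ℓ + 1) / 2 - (A.1.2 : ℚ)) : ℚ) : Fh) * hb ^ 2) •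
        ket ℓ (A.1.1 - 1, A.1.2 - 1))

/-- `H |A₁,A₂⟩ = (A₁ + A₂ + 1 - (2ℓ+1)/2) ℏ |A₁, A₂⟩`. -/
def opH (ℓ : ℕ) : V ℓ →ₗ[Fh] V ℓ :=
  Finsupp.lsum Fh fun A =>
    LinearMap.toSpanSingleton Fh (V ℓ)
      (((((A.1.1 : ℚ) + (A.1.2 : ℚ) + 1 - (2 * ℓ + 1) / 2 : ℚ) : Fh) * hb) •
        ket ℓ (A.1.1, A.1.2))

/-- `X |A₁,A₂⟩ = ((A₂-A₁-2ℓ-1)/(A₂-A₁-(2ℓ+1)/2)) |A₁,A₂+1⟩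
              + ((A₂-A₁)/(A₂-A₁-(2ℓ+1)/2)) |A₁+1,A₂⟩`. -/
def opX (ℓ : ℕ) : V ℓ →ₗ[Fh] V ℓ :=
  Finsupp.lsum Fh fun A =>
    LinearMap.toSpanSingleton Fh (V ℓ)
      (((((A.1.2 : ℚ) - (A.1.1 : ℚ) - (2 * ℓ + 1)) /
            ((A.1.2 : ℚ) - (A.1.1 : ℚ) - (2 * ℓ + 1) / 2) : ℚ) : Fh) •
          ket ℓ (A.1.1, A.1.2 + 1) +
        ((((A.1.2 : ℚ) - (A.1.1 : ℚ)) /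
            ((A.1.2 : ℚ) - (A.1.1 : ℚ) - (2 * ℓ + 1) / 2) : ℚ) : Fh) •
          ket ℓ (A.1.1 + 1, A.1.2))

/-- `Y |A₁,A₂⟩ = ((A₂-A₁)((2ℓ+1)/2-A₂)ℏ/(A₂-A₁-(2ℓ+1)/2)) |A₁,A₂-1⟩
              + (A₁(2ℓ+1-A₂+A₁)ℏ/(A₂-A₁-(2ℓ+1)/2)) |A₁-1,A₂⟩`. -/
def opY (ℓ : ℕ) : V ℓ →ₗ[Fh] V ℓ :=
  Finsupp.lsum Fh fun A =>
    LinearMap.toSpanSingleton Fh (V ℓ)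
      ((((((A.1.2 : ℚ) - (A.1.1 : ℚ)) * ((2 * ℓ + 1) / 2 - (A.1.2 : ℚ)) /
            ((A.1.2 : ℚ) - (A.1.1 : ℚ) - (2 * ℓ + 1) / 2) : ℚ) : Fh) * hb) •
          ket ℓ (A.1.1, A.1.2 - 1) +
        (((((A.1.1 : ℚ) * (2 * ℓ + 1 - (A.1.2 : ℚ) + (A.1.1 : ℚ))) /
            ((A.1.2 : ℚ) - (A.1.1 : ℚ) - (2 * ℓ + 1) / 2) : ℚ) : Fh) * hb) •
          ket ℓ (A.1.1 - 1, A.1.2))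

/-- `W⁺ = X²/2`. -/
def Wp (ℓ : ℕ) : V ℓ →ₗ[Fh] V ℓ := ((2 : Fh)⁻¹) • (opX ℓ ∘ₗ opX ℓ)

/-- `W⁰ = -(XY + YX)/2`. -/
def W0 (ℓ : ℕ) : V ℓ →ₗ[Fh] V ℓ :=
  -(((2 : Fh)⁻¹) • (opX ℓ ∘ₗ opY ℓ + opY ℓ ∘ₗ opX ℓ))

/-- `W⁻ = -Y²/2`. -/
def Wm (ℓ : ℕ) : V ℓ →ₗ[Fh] V ℓ := -(((2 : Fh)⁻¹) • (opY ℓ ∘ₗ opY ℓ))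

/-- The formal space with all integer indices. -/
abbrev VZ : Type := (ℤ × ℤ) →₀ Fh

def kz (a b : ℤ) : VZ := Finsupp.single (a, b) 1

def liftZ (f : ℤ → ℤ → VZ) : VZ →ₗ[Fh] VZ :=
  Finsupp.lsum Fh fun A => LinearMap.toSpanSingleton Fh VZ (f A.1 A.2)

theorem liftZ_kz (f : ℤ → ℤ → VZ) (a b : ℤ) : liftZ f (kz a b) = f a b := by
  simp [liftZ, kz]

def zE : VZ →ₗ[Fh] VZ := liftZ fun a b => kz (a + 1) (b + 1)

def zF (ℓ : ℕ) : VZ →ₗ[Fh] VZ := liftZ fun a b =>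
  ((a : Fh) * ((2 * (ℓ : Fh) + 1) / 2 - (b : Fh)) * hb ^ 2) • kz (a - 1) (b - 1)

def zH (ℓ : ℕ) : VZ →ₗ[Fh] VZ := liftZ fun a b =>
  (((a : Fh) + (b : Fh) + 1 - (2 * (ℓ : Fh) + 1) / 2) * hb) • kz a b

def zX (ℓ : ℕ) : VZ →ₗ[Fh] VZ := liftZ fun a b =>
  (((b : Fh) - a - (2 * (ℓ : Fh) + 1)) / ((b : Fh) - a - (2 * (ℓ : Fh) + 1) / 2)) • kz a (b + 1) +
  (((b : Fh) - a) / ((b : Fh) - a - (2 * (ℓ : Fh) + 1) / 2)) • kz (a + 1) b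

def zY (ℓ : ℕ) : VZ →ₗ[Fh] VZ := liftZ fun a b =>
  (((b : Fh) - a) * ((2 * (ℓ : Fh) + 1) / 2 - b) / ((b : Fh) - a - (2 * (ℓ : Fh) + 1) / 2) * hb) •
    kz a (b - 1) +
  ((a : Fh) * (2 * (ℓ : Fh) + 1 - b + a) / ((b : Fh) - a - (2 * (ℓ : Fh) + 1) / 2) * hb) •
    kz (a - 1) b

def incl (ℓ : ℕ) : V ℓ →ₗ[Fh] VZ := Finsupp.lmapDomain Fh Fh Subtype.val

theorem incl_injective (ℓ : ℕ) : Function.Injective (incl ℓ) :=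
  Finsupp.mapDomain_injective Subtype.val_injective

theorem incl_single (ℓ : ℕ) (a b : ℤ) (h : Adm ℓ (a, b)) :
    incl ℓ (Finsupp.single ⟨(a, b), h⟩ 1) = kz a b := by
  simp [incl, kz, Finsupp.mapDomain_single]

theorem incl_smul_ket (ℓ : ℕ) (a b : ℤ) (c : Fh) (h : ¬ Adm ℓ (a, b) → c = 0) :
    c • incl ℓ (ket ℓ (a, b)) = c • kz a b := by
  by_cases hA : Adm ℓ (a, b)
  · rw [ket, dif_pos hA, incl_single]
  · simp [h hA]

theorem incl_E (ℓ : ℕ) (v : V ℓ) : incl ℓ (opE ℓ v) = zE (incl ℓ v) := by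
  suffices H : incl ℓ ∘ₗ opE ℓ = zE ∘ₗ incl ℓ from LinearMap.congr_fun H v
  ext1 ⟨⟨a, b⟩, h⟩
  ext1
  simp only [LinearMap.comp_apply, Finsupp.lsingle_apply, incl_single, zE, liftZ_kz]
  have := incl_smul_ket ℓ (a + 1) (b + 1) 1 (fun h' => by
    exfalso; apply h'; simp only [Adm] at h ⊢; omega)
  simpa [opE] using this

theorem incl_F (ℓ : ℕ) (v : V ℓ) : incl ℓ (opF ℓ v) = zF ℓ (incl ℓ v) := by
  suffices H : incl ℓ ∘ₗ opF ℓ = zF ℓ ∘ₗ incl ℓ from LinearMap.congr_fun H v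
  ext1 ⟨⟨a, b⟩, h⟩
  ext1
  simp only [LinearMap.comp_apply, Finsupp.lsingle_apply, incl_single, zF, liftZ_kz]
  rw [← incl_smul_ket ℓ (a - 1) (b - 1)]
  · simp [opF]
  · intro h'
    have : a = 0 := by simp only [Adm] at h h'; omega
    simp [this]

theorem incl_H (ℓ : ℕ) (v : V ℓ) : incl ℓ (opH ℓ v) = zH ℓ (incl ℓ v) := by
  suffices H : incl ℓ ∘ₗ opH ℓ = zH ℓ ∘ₗ incl ℓ from LinearMap.congr_fun H v
  ext1 ⟨⟨a, b⟩, h⟩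
  ext1
  simp only [LinearMap.comp_apply, Finsupp.lsingle_apply, incl_single, zH, liftZ_kz]
  rw [← incl_smul_ket ℓ a b]
  · simp [opH]
  · exact fun h' => absurd h h'

theorem incl_X (ℓ : ℕ) (v : V ℓ) : incl ℓ (opX ℓ v) = zX ℓ (incl ℓ v) := by
  suffices H : incl ℓ ∘ₗ opX ℓ = zX ℓ ∘ₗ incl ℓ from LinearMap.congr_fun H v
  ext1 ⟨⟨a, b⟩, h⟩
  ext1
  simp only [LinearMap.comp_apply, Finsupp.lsingle_apply, incl_single, zX, liftZ_kz]
  rw [← incl_smul_ket ℓ a (b + 1), ← incl_smul_ket ℓ (a + 1) b]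
  · simp [opX]
  · intro h'
    have : b = a := by simp only [Adm] at h h'; omega
    simp [this]
  · intro h'
    have : b = a + (2 * ℓ + 1) := by simp only [Adm] at h h'; omega
    simp [this]

theorem incl_Y (ℓ : ℕ) (v : V ℓ) : incl ℓ (opY ℓ v) = zY ℓ (incl ℓ v) := by
  suffices H : incl ℓ ∘ₗ opY ℓ = zY ℓ ∘ₗ incl ℓ from LinearMap.congr_fun H v
  ext1 ⟨⟨a, b⟩, h⟩
  ext1
  simp only [LinearMap.comp_apply, Finsupp.lsingle_apply, incl_single, zY, liftZ_kz]
  rw [← incl_smul_ket ℓ a (b - 1), ← incl_smul_ket ℓ (a - 1) b]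
  · simp [opY]
  · intro h'
    have : a = 0 ∨ b = a + (2 * ℓ + 1) := by simp only [Adm] at h h'; omega
    rcases this with h0 | h0 <;> simp [h0]
  · intro h'
    have : b = a := by simp only [Adm] at h h'; omega
    simp [this]

theorem den_ne (ℓ : ℕ) (a b k : ℤ) :
    (b : Fh) - a - (2 * (ℓ : Fh) + 1) / 2 + k ≠ 0 := by
  intro h
  have h2 : ((2 * b - 2 * a - (2 * ℓ + 1) + 2 * k : ℤ) : Fh) = 0 := by
    push_cast
    linear_combination 2 * h
  have h3 : (2 * b - 2 * a - (2 * ℓ + 1) + 2 * k : ℤ) = 0 := by exact_mod_cast h2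
  omega

theorem formal (ℓ : ℕ) (a b : ℤ) :
    (2 : Fh) • (zE (zF ℓ (kz a b)) + zF ℓ (zE (kz a b))) + zH ℓ (zH ℓ (kz a b)) =
      (2 : Fh) • (-((2 : Fh)⁻¹ • zE (zY ℓ (zY ℓ (kz a b)))) +
        (2 : Fh)⁻¹ • zF ℓ (zX ℓ (zX ℓ (kz a b)))) +
      -((2 : Fh)⁻¹ • (zH ℓ (zX ℓ (zY ℓ (kz a b))) + zH ℓ (zY ℓ (zX ℓ (kz a b))))) +
      (-((2 * (ℓ : Fh) + 1) / 2) * hb * (-((2 * (ℓ : Fh) + 1) / 2) * hb - hb)) • kz a b := by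
  simp only [zE, zF, zH, zX, zY, liftZ_kz, map_add, map_smul, smul_add, smul_smul,
    sub_add_cancel, add_sub_cancel_right, Int.cast_add, Int.cast_sub, Int.cast_one]
  have d0 := den_ne ℓ a b 0
  have d1 := den_ne ℓ a b 1
  have d2 := den_ne ℓ a b (-1)
  have two : (2 : Fh) ≠ 0 := two_ne_zero
  push_cast at d0 d1 d2
  obtain ⟨d, hd⟩ : ∃ d : Fh, d = (b : Fh) - a - (2 * (ℓ : Fh) + 1) / 2 := ⟨_, rfl⟩
  rw [← hd] at d0 d1 d2
  rw [add_zero] at d0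
  generalize kz a b = k0
  generalize kz (a + 1) (b - 1) = k1
  generalize kz (a - 1) (b + 1) = k2
  have hb' : (b : Fh) = d + a + (2 * (ℓ : Fh) + 1) / 2 := by rw [hd]; ring
  rw [hb']
  generalize (a : Fh) = x
  generalize (ℓ : Fh) = L
  have q0 : d + x + (2 * L + 1) / 2 - x - (2 * L + 1) / 2 = d := by ring
  have q1 : d + x + (2 * L + 1) / 2 + 1 - x - (2 * L + 1) / 2 = d + 1 := by ring
  have q2 : d + x + (2 * L + 1) / 2 - 1 - x - (2 * L + 1) / 2 = d + -1 := by ring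
  have q3 : d + x + (2 * L + 1) / 2 - (x + 1) - (2 * L + 1) / 2 = d + -1 := by ring
  have q4 : d + x + (2 * L + 1) / 2 - (x - 1) - (2 * L + 1) / 2 = d + 1 := by ring
  simp only [q0, q1, q2, q3, q4]
  clear hd hb' q0 q1 q2 q3 q4
  apply Finsupp.ext
  intro p
  simp only [Finsupp.add_apply, Finsupp.smul_apply, Finsupp.neg_apply, smul_eq_mul]
  generalize k0 p = u0
  generalize k1 p = u1
  generalize k2 p = u2
  generalize hb = t
  field_simp
  ring

/-- the Casimir relation
`2(EF + FE) + H² = 2(EW⁻ + FW⁺) + HW⁰ + m(m-ℏ)` holds on `V`, with `m = -((2ℓ+1)/2)ℏ`. -/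
theorem stmt9 (ℓ : ℕ) :
    (2 : Fh) • (opE ℓ ∘ₗ opF ℓ + opF ℓ ∘ₗ opE ℓ) + opH ℓ ∘ₗ opH ℓ =
      (2 : Fh) • (opE ℓ ∘ₗ Wm ℓ + opF ℓ ∘ₗ Wp ℓ) + opH ℓ ∘ₗ W0 ℓ +
        (((-((2 * ℓ + 1) / 2 : ℚ)) : Fh) * hb *
            ((((-((2 * ℓ + 1) / 2 : ℚ)) : Fh) * hb) - hb)) •
          (LinearMap.id : V ℓ →ₗ[Fh] V ℓ) := by
  apply LinearMap.ext
  intro v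
  apply incl_injective ℓ
  have key : ∀ w : VZ,
    (2 : Fh) • (zE (zF ℓ w) + zF ℓ (zE w)) + zH ℓ (zH ℓ w) =
      (2 : Fh) • (-((2 : Fh)⁻¹ • zE (zY ℓ (zY ℓ w))) +
        (2 : Fh)⁻¹ • zF ℓ (zX ℓ (zX ℓ w))) +
      -((2 : Fh)⁻¹ • (zH ℓ (zX ℓ (zY ℓ w)) + zH ℓ (zY ℓ (zX ℓ w)))) +
      (-((2 * (ℓ : Fh) + 1) / 2) * hb * (-((2 * (ℓ : Fh) + 1) / 2) * hb - hb)) • w := by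
    intro w
    suffices H : (2 : Fh) • (zE ∘ₗ zF ℓ + zF ℓ ∘ₗ zE) + zH ℓ ∘ₗ zH ℓ =
      (2 : Fh) • (-((2 : Fh)⁻¹ • (zE ∘ₗ zY ℓ ∘ₗ zY ℓ)) +
        (2 : Fh)⁻¹ • (zF ℓ ∘ₗ zX ℓ ∘ₗ zX ℓ)) +
      -((2 : Fh)⁻¹ • (zH ℓ ∘ₗ zX ℓ ∘ₗ zY ℓ + zH ℓ ∘ₗ zY ℓ ∘ₗ zX ℓ)) +
      (-((2 * (ℓ : Fh) + 1) / 2) * hb * (-((2 * (ℓ : Fh) + 1) / 2) * hb - hb)) •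
        LinearMap.id from LinearMap.congr_fun H w
    ext1 ⟨a, b⟩
    ext1
    exact formal ℓ a b
  have := key (incl ℓ v)
  simpa only [Wm, Wp, W0, LinearMap.add_apply, LinearMap.smul_apply, LinearMap.neg_apply,
    LinearMap.comp_apply, LinearMap.id_apply, map_add, map_neg, map_smul, incl_E, incl_F, incl_H,
    incl_X, incl_Y, Rat.cast_div, Rat.cast_add, Rat.cast_mul, Rat.cast_natCast, Rat.cast_ofNat,
    Rat.cast_one, Rat.cast_neg] using this
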